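/- Let d ≥ 2, α ≥ 1, let 𝒦 satisfy (K1)–(K3), and let 𝔐 satisfy (M) and be continuous. For Borel probability measures μ on S^{d−1} and Θ on ℝ^α define m_μ(x, θ) = ∫_{S^{d−1}} 𝔐(x, z, θ) dμ(z), b_μ^Θ(x) = (∫_{ℝ^α} m_μ(x, θ)^{-1} dΘ(θ))^{-1}, 𝒟𝒦[μ](x, θ) = ∫_{S^{d−1}} P_x^⊥(∇_x𝒦(x, y, θ)) dμ(y), and the strong upper gradient 𝒢(μ, Θ) = ( ∫_{S^{d−1}} b_μ^Θ(x)·‖ ∫_{ℝ^α} 𝒟𝒦[μ](x, θ)/m_μ(x, θ) dΘ(θ) ‖² dμ(x) )^{1/2}. Let (μ_n) be Borel probability measures on S^{d−1} converging narrowly to μ, and let (Θ_n) be Borel probability measures on ℝ^α, each supported in a fixed compact set, converging narrowly to Θ. Then liminf_{n→∞} 𝒢(μ_n, Θ_n) ≥ 𝒢(μ, Θ). -/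

import Mathlib

open MeasureTheory Filter Topology Set
open scoped RealInnerProductSpace

noncomputable section

abbrev Ed (n : ℕ) := EuclideanSpace ℝ (Fin n)

/-- The unit sphere `S^{d−1}` in `ℝ^d`. -/
def Sph (d : ℕ) : Set (Ed d) := {x | ‖x‖ = 1}

/-- Tangential projection `P_x^⊥ y = y − ⟨y, x⟩ x`. -/
def Pperp {d : ℕ} (x y : Ed d) : Ed d := y - ⟪y, x⟫ • x

/-- Nonlinear mobility `m_μ(x,θ) = ∫ 𝔐(x,z,θ) dμ(z)`. -/
def mMob {d α : ℕ} (M : Ed d → Ed d → Ed α → ℝ) (μ : Measure (Ed d))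
    (x : Ed d) (θ : Ed α) : ℝ := ∫ z, M x z θ ∂μ

/-- Effective mobility: the `Θ`-weighted harmonic mean
`b_μ^Θ(x) = (∫ m_μ(x,θ)⁻¹ dΘ(θ))⁻¹`. -/
def bEff {d α : ℕ} (M : Ed d → Ed d → Ed α → ℝ) (μ : Measure (Ed d))
    (Θ : Measure (Ed α)) (x : Ed d) : ℝ := (∫ θ, (mMob M μ x θ)⁻¹ ∂Θ)⁻¹

/-- `𝒟𝒦[μ](x,θ) = ∫ P_x^⊥(∇_x𝒦(x,y,θ)) dμ(y)`. -/
def DKer {d α : ℕ} (Kgrad : Ed d → Ed d → Ed α → Ed d) (μ : Measure (Ed d))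
    (x : Ed d) (θ : Ed α) : Ed d := ∫ y, Pperp x (Kgrad x y θ) ∂μ

/-- The strong upper gradient
`𝒢(μ,Θ) = ( ∫ b_μ^Θ(x) ‖ ∫ 𝒟𝒦[μ](x,θ)/m_μ(x,θ) dΘ ‖² dμ )^{1/2}`. -/
def Gup {d α : ℕ} (M : Ed d → Ed d → Ed α → ℝ) (Kgrad : Ed d → Ed d → Ed α → Ed d)
    (μ : Measure (Ed d)) (Θ : Measure (Ed α)) : ℝ :=
  Real.sqrt (∫ x, bEff M μ Θ x *
    ‖∫ θ, (mMob M μ x θ)⁻¹ • DKer Kgrad μ x θ ∂Θ‖ ^ 2 ∂μ)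

/-- Narrow convergence of a sequence of measures. -/
def NarrowTendsto {X : Type*} [TopologicalSpace X] [MeasurableSpace X]
    (μn : ℕ → Measure X) (μ : Measure X) : Prop :=
  ∀ φ : BoundedContinuousFunction X ℝ,
    Tendsto (fun n => ∫ x, φ x ∂(μn n)) atTop (𝓝 (∫ x, φ x ∂μ))

/-! ### Averaging continuous functions against weakly convergent measures -/

/-- Continuous functions on a compact metric space are uniformly approximated by finite sums of
their values weighted by continuous scalar functions. -/
theorem exists_sum_smul_approximation {Y F : Type*} [MetricSpace Y] [CompactSpace Y]
    [NormedAddCommGroup F] [NormedSpace ℝ F] (h : C(Y, F)) {ε : ℝ} (hε : 0 < ε) :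
    ∃ (s : Finset Y) (ρ : s → C(Y, ℝ)), ∀ x, ‖h x - ∑ i, ρ i x • h i‖ ≤ ε := by
  obtain ⟨s, hs⟩ := isCompact_univ.elim_finite_subcover
    (fun y : Y => h ⁻¹' Metric.ball (h y) ε)
    (fun y => Metric.isOpen_ball.preimage h.continuous)
    (fun x _ => mem_iUnion.2 ⟨x, by simpa using hε⟩)
  obtain ⟨ρ, hρ⟩ := PartitionOfUnity.exists_isSubordinate (isClosed_univ (X := Y))
    (fun i : s => h ⁻¹' Metric.ball (h i) ε)
    (fun i => Metric.isOpen_ball.preimage h.continuous)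
    (fun x hx => by simpa using hs hx)
  refine ⟨s, fun i => ρ i, fun x => ?_⟩
  have key := ρ.finsum_smul_mem_convex (g := fun i _ => h i) (t := Metric.closedBall (h x) ε)
    (mem_univ x) (fun i hi => ?_) (convex_closedBall _ _)
  · rw [finsum_eq_sum_of_fintype, mem_closedBall_iff_norm'] at key
    exact key
  · have hx := hρ i (subset_closure (Function.mem_support.2 hi))
    rw [Metric.mem_closedBall, dist_comm]
    exact (Metric.mem_ball.1 hx).le

section Averages

variable {X Y F : Type*} [TopologicalSpace X] [CompactSpace X]
  [MetricSpace Y] [CompactSpace Y] [MeasurableSpace Y] [NormedAddCommGroup F]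

theorem integrable_continuousMap [BorelSpace Y] (ν : Measure Y) [IsFiniteMeasure ν] (f : C(Y, F)) :
    Integrable f ν :=
  f.continuous.integrable_of_hasCompactSupport (.of_compactSpace f)

variable [NormedSpace ℝ F]

theorem norm_integral_le_norm_continuousMap (ν : Measure Y) [IsProbabilityMeasure ν]
    (f : C(Y, F)) : ‖∫ y, f y ∂ν‖ ≤ ‖f‖ := by
  simpa using norm_integral_le_of_norm_le_const (μ := ν) (.of_forall f.norm_coe_le_norm)

variable [BorelSpace Y]

/-- Weak convergence of probability measures on a compact space tests against continuous functions
with values in a Banach space, and the test functions may vary uniformly. -/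
theorem tendsto_integral_continuousMap {νn : ℕ → Measure Y} {ν : Measure Y}
    [∀ n, IsProbabilityMeasure (νn n)] [IsProbabilityMeasure ν] [CompleteSpace F]
    (hν : ∀ φ : C(Y, ℝ), Tendsto (fun n => ∫ y, φ y ∂νn n) atTop (𝓝 (∫ y, φ y ∂ν)))
    {hn : ℕ → C(Y, F)} {h : C(Y, F)} (hh : Tendsto hn atTop (𝓝 h)) :
    Tendsto (fun n => ∫ y, hn n y ∂νn n) atTop (𝓝 (∫ y, h y ∂ν)) := by
  rw [Metric.tendsto_atTop']
  intro ε hε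
  obtain ⟨s, ρ, hρ⟩ := exists_sum_smul_approximation h (ε := ε / 5) (by positivity)
  have happrox (m : Measure Y) [IsProbabilityMeasure m] :
      ‖(∫ y, h y ∂m) - ∑ i, (∫ y, ρ i y ∂m) • h i‖ ≤ ε / 5 := by
    have hint (i : s) : Integrable (fun y => ρ i y • h i) m :=
      (integrable_continuousMap m (ρ i)).smul_const _
    simp_rw [← integral_smul_const]
    rw [← integral_finsetSum _ fun i _ => hint i,
      ← integral_sub (integrable_continuousMap m h) (integrable_finsetSum _ fun i _ => hint i)]
    simpa using norm_integral_le_of_norm_le_const (μ := m) (.of_forall hρ)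
  have hsum : Tendsto (fun n => ∑ i, (∫ y, ρ i y ∂νn n) • h i) atTop
      (𝓝 (∑ i, (∫ y, ρ i y ∂ν) • h i)) :=
    tendsto_finsetSum _ fun i _ => (hν (ρ i)).smul_const _
  obtain ⟨N₁, hN₁⟩ := Metric.tendsto_atTop'.1 hsum (ε / 5) (by positivity)
  obtain ⟨N₂, hN₂⟩ := Metric.tendsto_atTop'.1 hh (ε / 5) (by positivity)
  refine ⟨max N₁ N₂, fun n hn' => ?_⟩
  have h₁ := hN₁ n ((le_max_left _ _).trans_lt hn')
  have h₂ := hN₂ n ((le_max_right _ _).trans_lt hn')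
  have h₃ : ‖(∫ y, hn n y ∂νn n) - ∫ y, h y ∂νn n‖ ≤ ‖hn n - h‖ := by
    rw [← integral_sub (integrable_continuousMap _ _) (integrable_continuousMap _ _)]
    exact norm_integral_le_norm_continuousMap _ (hn n - h)
  have h₄ := happrox (νn n)
  have h₅ := happrox ν
  rw [dist_eq_norm] at h₁ h₂ ⊢
  rw [norm_sub_rev] at h₅
  calc ‖(∫ y, hn n y ∂νn n) - ∫ y, h y ∂ν‖
      = ‖((∫ y, hn n y ∂νn n) - ∫ y, h y ∂νn n)
          + ((∫ y, h y ∂νn n) - ∑ i, (∫ y, ρ i y ∂νn n) • h i)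
          + ((∑ i, (∫ y, ρ i y ∂νn n) • h i) - ∑ i, (∫ y, ρ i y ∂ν) • h i)
          + ((∑ i, (∫ y, ρ i y ∂ν) • h i) - ∫ y, h y ∂ν)‖ := by congr 1; abel
    _ ≤ _ := norm_add₄_le
    _ < ε := by linarith

/-- Average of a continuous function over its first variable. -/
def average₁ (ν : Measure Y) (f : C(Y × X, F)) : C(X, F) := ∫ y, f.curry y ∂ν

theorem average₁_apply [CompleteSpace F] (ν : Measure Y) [IsFiniteMeasure ν] (f : C(Y × X, F))
    (x : X) : average₁ ν f x = ∫ y, f (y, x) ∂ν :=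
  ContinuousMap.integral_apply (integrable_continuousMap ν f.curry) x

theorem tendsto_average₁ [LocallyCompactSpace X] {νn : ℕ → Measure Y} {ν : Measure Y}
    [∀ n, IsProbabilityMeasure (νn n)] [IsProbabilityMeasure ν] [CompleteSpace F]
    (hν : ∀ φ : C(Y, ℝ), Tendsto (fun n => ∫ y, φ y ∂νn n) atTop (𝓝 (∫ y, φ y ∂ν)))
    {fn : ℕ → C(Y × X, F)} {f : C(Y × X, F)} (hf : Tendsto fn atTop (𝓝 f)) :
    Tendsto (fun n => average₁ (νn n) (fn n)) atTop (𝓝 (average₁ ν f)) :=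
  tendsto_integral_continuousMap hν ((ContinuousMap.continuous_curry.tendsto f).comp hf)

end Averages

theorem tendsto_prodMk {X Y Z ι : Type*} [TopologicalSpace X] [LocallyCompactSpace X]
    [TopologicalSpace Y] [TopologicalSpace Z] {l : Filter ι}
    {fn : ι → C(X, Y)} {f : C(X, Y)} {gn : ι → C(X, Z)} {g : C(X, Z)}
    (hf : Tendsto fn l (𝓝 f)) (hg : Tendsto gn l (𝓝 g)) :
    Tendsto (fun i => (fn i).prodMk (gn i)) l (𝓝 (f.prodMk g)) := by
  have h : Continuous fun p : C(X, Y) × C(X, Z) => p.1.prodMk p.2 :=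
    ContinuousMap.continuous_of_continuous_uncurry _ (by
      simp only [Function.uncurry_def, ContinuousMap.prod_eval]
      fun_prop)
  exact (h.tendsto (f, g)).comp (hf.prodMk_nhds hg)

/-! ### The squared gradient on compact spaces -/

section Compact

variable {X T E : Type*} [MetricSpace X] [CompactSpace X] [MeasurableSpace X] [BorelSpace X]
  [MetricSpace T] [CompactSpace T] [MeasurableSpace T] [BorelSpace T]
  [NormedAddCommGroup E] [NormedSpace ℝ E]

/-- Inversion truncated below the level `c`, continuous on `ℝ` when `0 < c`. -/
def truncInv (c t : ℝ) : ℝ := (max t c)⁻¹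

theorem continuous_truncInv {c : ℝ} (hc : 0 < c) : Continuous (truncInv c) :=
  (continuous_id.max continuous_const).inv₀ fun _ => (lt_max_of_lt_right hc).ne'

theorem truncInv_of_le {c t : ℝ} (h : c ≤ t) : truncInv c t = t⁻¹ := by
  rw [truncInv, max_eq_left h]

/-- Narrow limits pass to the integral of the squared gradient on compact spaces. -/
theorem tendsto_integral_sq_gradient [CompleteSpace E] {a b : ℝ} (ha : 0 < a) (hb : 0 < b)
    (m : C(X × (T × X), ℝ)) (g : C(X × (T × X), E))
    {νn : ℕ → Measure X} {ν : Measure X}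
    [∀ n, IsProbabilityMeasure (νn n)] [IsProbabilityMeasure ν]
    (hν : ∀ φ : C(X, ℝ), Tendsto (fun n => ∫ y, φ y ∂νn n) atTop (𝓝 (∫ y, φ y ∂ν)))
    {τn : ℕ → Measure T} {τ : Measure T}
    [∀ n, IsProbabilityMeasure (τn n)] [IsProbabilityMeasure τ]
    (hτ : ∀ φ : C(T, ℝ), Tendsto (fun n => ∫ y, φ y ∂τn n) atTop (𝓝 (∫ y, φ y ∂τ))) :
    Tendsto (fun n => ∫ x, truncInv b (∫ θ, truncInv a (∫ z, m (z, θ, x) ∂νn n) ∂τn n) *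
        ‖∫ θ, truncInv a (∫ z, m (z, θ, x) ∂νn n) • ∫ y, g (y, θ, x) ∂νn n ∂τn n‖ ^ 2 ∂νn n) atTop
      (𝓝 (∫ x, truncInv b (∫ θ, truncInv a (∫ z, m (z, θ, x) ∂ν) ∂τ) *
        ‖∫ θ, truncInv a (∫ z, m (z, θ, x) ∂ν) • ∫ y, g (y, θ, x) ∂ν ∂τ‖ ^ 2 ∂ν)) := by
  let φ : C(ℝ, ℝ) := ⟨truncInv a, continuous_truncInv ha⟩
  let W : C(ℝ × E, E) := ⟨fun p => truncInv a p.1 • p.2,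
    ((continuous_truncInv ha).comp continuous_fst).smul continuous_snd⟩
  let H : C(ℝ × E, ℝ) := ⟨fun p => truncInv b p.1 * ‖p.2‖ ^ 2,
    ((continuous_truncInv hb).comp continuous_fst).mul (continuous_snd.norm.pow 2)⟩
  have hm := tendsto_average₁ hν (tendsto_const_nhds (x := m))
  have hg := tendsto_average₁ hν (tendsto_const_nhds (x := g))
  have hA := tendsto_average₁ hτ ((φ.continuous_postcomp.tendsto _).comp hm)
  have hW := tendsto_average₁ hτ ((W.continuous_postcomp.tendsto _).comp (tendsto_prodMk hm hg))
  have hH := tendsto_integral_continuousMap hν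
    ((H.continuous_postcomp.tendsto _).comp (tendsto_prodMk hA hW))
  simpa [Function.comp_def, average₁_apply, φ, W, H] using hH

end Compact

/-! ### Restriction to a subset of full measure -/

section Restriction

variable {X : Type*} [MeasurableSpace X] {s : Set X}

theorem integral_eq_integral_comap_coe {F : Type*} [NormedAddCommGroup F] [NormedSpace ℝ F]
    (hs : MeasurableSet s) {μ : Measure X} (hμ : μ sᶜ = 0) (f : X → F) :
    ∫ x, f x ∂μ = ∫ x : s, f x ∂(μ.comap Subtype.val) := by
  rw [integral_subtype_comap hs, Measure.restrict_eq_self_of_ae_mem (mem_ae_iff.2 hμ)]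

theorem isProbabilityMeasure_comap_coe (hs : MeasurableSet s) {μ : Measure X}
    [IsProbabilityMeasure μ] (hμ : μ sᶜ = 0) :
    IsProbabilityMeasure (μ.comap (Subtype.val : s → X)) := by
  refine ⟨?_⟩
  rw [comap_subtype_coe_apply hs, image_univ, Subtype.range_coe]
  exact (prob_compl_eq_zero_iff hs).1 hμ

theorem NarrowTendsto.comap_coe [TopologicalSpace X] [NormalSpace X] [OpensMeasurableSpace X]
    (hs : IsCompact s) (hs' : IsClosed s) {μn : ℕ → Measure X} {μ : Measure X}
    (hμn : ∀ n, μn n sᶜ = 0) (hμ : μ sᶜ = 0) (h : NarrowTendsto μn μ) (φ : C(s, ℝ)) :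
    Tendsto (fun n => ∫ x, φ x ∂((μn n).comap Subtype.val)) atTop
      (𝓝 (∫ x, φ x ∂(μ.comap Subtype.val))) := by
  have := isCompact_iff_compactSpace.1 hs
  obtain ⟨g, -, hg⟩ :=
    (BoundedContinuousFunction.mkOfCompact φ).exists_norm_eq_domRestrict_eq_of_closed hs'
  have hφ (x : s) : φ x = g x := by simpa using! (DFunLike.congr_fun hg x).symm
  simp_rw [hφ]
  have := h g
  simp_rw [integral_eq_integral_comap_coe hs'.measurableSet (hμn _) g,
    integral_eq_integral_comap_coe hs'.measurableSet hμ g] at this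
  exact this

theorem NarrowTendsto.compl_eq_zero {X : Type*} [MetricSpace X] [MeasurableSpace X]
    [OpensMeasurableSpace X] {s : Set X}
    (hs : IsClosed s) {μn : ℕ → Measure X} {μ : Measure X} [∀ n, IsProbabilityMeasure (μn n)]
    [IsProbabilityMeasure μ] (hμn : ∀ n, μn n sᶜ = 0) (h : NarrowTendsto μn μ) : μ sᶜ = 0 := by
  have hne : s.Nonempty := by
    rw [nonempty_iff_ne_empty]
    rintro rfl
    simpa using hμn 0
  let φ : BoundedContinuousFunction X ℝ := .ofNormedAddCommGroup
    (fun x => min 1 (Metric.infDist x s))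
    (continuous_const.min (Metric.continuous_infDist_pt s)) 1 fun x => by
      rw [Real.norm_of_nonneg (le_min zero_le_one Metric.infDist_nonneg)]
      exact min_le_left _ _
  have hφ : ∀ x ∈ s, φ x = 0 := fun x hx => by
    simp [φ, Metric.infDist_zero_of_mem hx]
  have hn (n : ℕ) : ∫ x, φ x ∂μn n = 0 :=
    integral_eq_zero_of_ae (mem_of_superset (mem_ae_iff.2 (hμn n)) hφ)
  have h0 : ∫ x, φ x ∂μ = 0 :=
    tendsto_nhds_unique (h φ) (by simp [hn])
  have hae := (integral_eq_zero_iff_of_nonneg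
    (fun x => le_min zero_le_one Metric.infDist_nonneg) (φ.integrable μ)).1 h0
  refine mem_ae_iff.1 (mem_of_superset hae fun x hx => ?_)
  by_contra hxs
  exact (lt_min zero_lt_one ((hs.notMem_iff_infDist_pos hne).1 hxs)).ne' hx

end Restriction

/-! ### Regularity of the tangential gradient of the kernel -/

/-- A derivative that is Lipschitz at the origin, uniformly in a parameter, inherits the
continuity in that parameter of the function. -/
theorem continuous_deriv_of_uniform_lipschitz {T : Type*} [TopologicalSpace T]
    {F F' : ℝ → T → ℝ} {L : ℝ} (hF : ∀ t, Continuous (F t))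
    (hd : ∀ θ t, HasDerivAt (fun s => F s θ) (F' t θ) t)
    (hL : ∀ θ, ∀ t ∈ Icc (0 : ℝ) 1, |F' t θ - F' 0 θ| ≤ L * t) :
    Continuous (F' 0) := by
  have hbound (θ : T) (t : ℝ) (ht : t ∈ Ioc (0 : ℝ) 1) :
      |t⁻¹ * (F t θ - F 0 θ) - F' 0 θ| ≤ |L| * t := by
    have hmv := norm_image_sub_le_of_norm_deriv_le_segment' (a := 0) (b := t) (C := |L| * t)
      (f := fun s => F s θ - s * F' 0 θ) (f' := fun s => F' s θ - F' 0 θ)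
      (fun s _ => by
        simpa using ((hd θ s).fun_sub ((hasDerivAt_id s).mul_const (F' 0 θ))).hasDerivWithinAt)
      (fun s hs => (hL θ s ⟨hs.1, hs.2.le.trans ht.2⟩).trans
        (mul_le_mul (le_abs_self L) hs.2.le hs.1 (abs_nonneg L)))
      t ⟨ht.1.le, le_rfl⟩
    have heq : t⁻¹ * (F t θ - F 0 θ) - F' 0 θ = t⁻¹ * (F t θ - t * F' 0 θ - F 0 θ) := by
      field_simp [ht.1.ne']
      ring
    rw [heq, abs_mul, abs_inv, abs_of_pos ht.1, inv_mul_le_iff₀ ht.1]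
    simpa [mul_comm] using hmv
  have hunif : TendstoUniformly (fun (t : ℝ) θ => t⁻¹ * (F t θ - F 0 θ)) (F' 0) (𝓝[>] 0) := by
    rw [Metric.tendstoUniformly_iff]
    intro ε hε
    have hlim : Tendsto (fun t : ℝ => |L| * t) (𝓝[>] 0) (𝓝 0) :=
      (Continuous.tendsto' (by fun_prop) 0 0 (by simp)).mono_left nhdsWithin_le_nhds
    filter_upwards [hlim.eventually (gt_mem_nhds hε), Ioc_mem_nhdsGT zero_lt_one] with t ht ht' θ
    rw [dist_comm, Real.dist_eq]
    exact (hbound θ t ht').trans_lt ht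
  exact hunif.continuous (.of_forall fun t => continuous_const.mul ((hF t).sub (hF 0)))

section Sphere

variable {d : ℕ}

theorem inner_Pperp (x u w : Ed d) : ⟪w, Pperp x u⟫ = ⟪u, Pperp x w⟫ := by
  simp only [Pperp, inner_sub_right, inner_smul_right, real_inner_comm]
  ring

theorem inner_Pperp_self {x : Ed d} (hx : x ∈ Sph d) (u : Ed d) : ⟪x, Pperp x u⟫ = 0 := by
  have : ‖x‖ = 1 := hx
  simp [Pperp, inner_sub_right, inner_smul_right, real_inner_comm, this]

theorem norm_Pperp_sub_le {x x' : Ed d} (hx : x ∈ Sph d) (hx' : x' ∈ Sph d) (u u' : Ed d) :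
    ‖Pperp x u - Pperp x' u'‖ ≤ 2 * ‖u - u'‖ + 2 * ‖u'‖ * ‖x - x'‖ := by
  have hx1 : ‖x‖ = 1 := hx
  have hx1' : ‖x'‖ = 1 := hx'
  have heq : Pperp x u - Pperp x' u' =
      (u - u') - ⟪u - u', x⟫ • x - (⟪u', x - x'⟫ • x + ⟪u', x'⟫ • (x - x')) := by
    simp only [Pperp, inner_sub_left, inner_sub_right]
    module
  have h₁ : ‖⟪u - u', x⟫ • x‖ ≤ ‖u - u'‖ := by
    rw [norm_smul, hx1, mul_one]
    simpa [hx1] using norm_inner_le_norm (𝕜 := ℝ) (u - u') x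
  have h₂ : ‖⟪u', x - x'⟫ • x‖ ≤ ‖u'‖ * ‖x - x'‖ := by
    rw [norm_smul, hx1, mul_one]
    exact norm_inner_le_norm (𝕜 := ℝ) u' (x - x')
  have h₃ : ‖⟪u', x'⟫ • (x - x')‖ ≤ ‖u'‖ * ‖x - x'‖ := by
    rw [norm_smul]
    gcongr
    simpa [hx1'] using norm_inner_le_norm (𝕜 := ℝ) u' x'
  rw [heq]
  linarith [norm_sub_le ((u - u') - ⟪u - u', x⟫ • x) (⟪u', x - x'⟫ • x + ⟪u', x'⟫ • (x - x')),
    norm_sub_le (u - u') (⟪u - u', x⟫ • x), norm_add_le (⟪u', x - x'⟫ • x) (⟪u', x'⟫ • (x - x'))]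

theorem cos_smul_add_sin_smul_mem_Sph {x v : Ed d} (hx : x ∈ Sph d) (hv : v ∈ Sph d)
    (hxv : ⟪x, v⟫ = 0) (t : ℝ) : Real.cos t • x + Real.sin t • v ∈ Sph d := by
  have hx1 : ‖x‖ = 1 := hx
  have hv1 : ‖v‖ = 1 := hv
  have h : ‖Real.cos t • x + Real.sin t • v‖ ^ 2 = 1 := by
    rw [norm_add_sq_real, norm_smul, norm_smul, inner_smul_left, inner_smul_right, hxv, hx1, hv1]
    simp
  exact (sq_eq_sq₀ (norm_nonneg _) zero_le_one).1 (by rw [h, one_pow])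

/-- If a family of functions is pointwise continuous in the parameter and its gradients are
bounded and Lipschitz on the sphere uniformly in the parameter, then tangential derivatives
are continuous in the parameter. -/
theorem continuous_inner_gradient {T : Type*} [TopologicalSpace T] {f : Ed d → T → ℝ}
    {G : Ed d → T → Ed d} {B L : ℝ} (hf : ∀ x, Continuous (f x))
    (hG : ∀ θ x, HasGradientAt (fun x' => f x' θ) (G x θ) x)
    (hB : ∀ x ∈ Sph d, ∀ θ, ‖G x θ‖ ≤ B)
    (hL : ∀ x ∈ Sph d, ∀ x' ∈ Sph d, ∀ θ, ‖G x θ - G x' θ‖ ≤ L * ‖x - x'‖)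
    {x v : Ed d} (hx : x ∈ Sph d) (hv : v ∈ Sph d) (hxv : ⟪x, v⟫ = 0) :
    Continuous fun θ => ⟪G x θ, v⟫ := by
  let γ : ℝ → Ed d := fun t => Real.cos t • x + Real.sin t • v
  let γ' : ℝ → Ed d := fun t => -Real.sin t • x + Real.cos t • v
  have hx1 : ‖x‖ = 1 := hx
  have hv1 : ‖v‖ = 1 := hv
  have hγ0 : γ 0 = x := by simp [γ]
  have hγ0' : γ' 0 = v := by simp [γ']
  have hγmem (t : ℝ) : γ t ∈ Sph d := cos_smul_add_sin_smul_mem_Sph hx hv hxv t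
  have hγd (t : ℝ) : HasDerivAt γ (γ' t) t :=
    ((Real.hasDerivAt_cos t).smul_const x).add ((Real.hasDerivAt_sin t).smul_const v)
  have hcos (t : ℝ) (ht : t ∈ Icc (0 : ℝ) 1) : |Real.cos t - 1| ≤ t := by
    rw [abs_le]
    constructor <;>
      nlinarith [Real.one_sub_sq_div_two_le_cos (x := t), Real.cos_le_one t, ht.1, ht.2]
  have hsin (t : ℝ) (ht : t ∈ Icc (0 : ℝ) 1) : |Real.sin t| ≤ t := by
    simpa [abs_of_nonneg ht.1] using Real.abs_sin_le_abs (x := t)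
  have hγdist (t : ℝ) (ht : t ∈ Icc (0 : ℝ) 1) : ‖γ t - x‖ ≤ 2 * t := by
    have : γ t - x = (Real.cos t - 1) • x + Real.sin t • v := by simp only [γ]; module
    rw [this]
    refine (norm_add_le _ _).trans ?_
    simp only [norm_smul, hx1, hv1, Real.norm_eq_abs]
    linarith [hcos t ht, hsin t ht]
  have hγdist' (t : ℝ) (ht : t ∈ Icc (0 : ℝ) 1) : ‖γ' t - v‖ ≤ 2 * t := by
    have : γ' t - v = (-Real.sin t) • x + (Real.cos t - 1) • v := by simp only [γ']; module
    rw [this]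
    refine (norm_add_le _ _).trans ?_
    simp only [norm_smul, hx1, hv1, Real.norm_eq_abs, abs_neg]
    linarith [hcos t ht, hsin t ht]
  have key := continuous_deriv_of_uniform_lipschitz
    (F := fun t θ => f (γ t) θ) (F' := fun t θ => ⟪G (γ t) θ, γ' t⟫) (L := 2 * |B| + 2 * |L|)
    (fun t => hf (γ t))
    (fun θ t => by
      simpa [Function.comp_def] using! (hG θ (γ t)).hasFDerivAt.comp_hasDerivAt t (hγd t))
    (fun θ t ht => by
      rw [hγ0, hγ0']
      have heq : ⟪G (γ t) θ, γ' t⟫ - ⟪G x θ, v⟫ =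
          ⟪G (γ t) θ, γ' t - v⟫ + ⟪G (γ t) θ - G x θ, v⟫ := by
        rw [inner_sub_left, inner_sub_right]; ring
      have h₁ : |⟪G (γ t) θ, γ' t - v⟫| ≤ |B| * (2 * t) :=
        (abs_real_inner_le_norm _ _).trans <|
          mul_le_mul ((hB _ (hγmem t) θ).trans (le_abs_self B)) (hγdist' t ht)
            (norm_nonneg _) (abs_nonneg B)
      have h₂ : |⟪G (γ t) θ - G x θ, v⟫| ≤ |L| * (2 * t) := by
        refine (abs_real_inner_le_norm _ _).trans ?_
        rw [hv1, mul_one]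
        exact (hL _ (hγmem t) _ hx θ).trans
          (mul_le_mul (le_abs_self L) (hγdist t ht) (norm_nonneg _) (abs_nonneg L))
      rw [heq]
      linarith [abs_add_le ⟪G (γ t) θ, γ' t - v⟫ ⟪G (γ t) θ - G x θ, v⟫])
  simpa [hγ0, hγ0'] using key

theorem continuous_Pperp_gradient {T : Type*} [TopologicalSpace T] {f : Ed d → T → ℝ}
    {G : Ed d → T → Ed d} {B L : ℝ} (hf : ∀ x, Continuous (f x))
    (hG : ∀ θ x, HasGradientAt (fun x' => f x' θ) (G x θ) x)
    (hB : ∀ x ∈ Sph d, ∀ θ, ‖G x θ‖ ≤ B)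
    (hL : ∀ x ∈ Sph d, ∀ x' ∈ Sph d, ∀ θ, ‖G x θ - G x' θ‖ ≤ L * ‖x - x'‖)
    {x : Ed d} (hx : x ∈ Sph d) : Continuous fun θ => Pperp x (G x θ) := by
  have hinner (w : Ed d) : Continuous fun θ => ⟪w, Pperp x (G x θ)⟫ := by
    rw [funext fun θ => inner_Pperp x (G x θ) w]
    by_cases hw : Pperp x w = 0
    · simpa [hw] using continuous_const
    have hw' : ‖Pperp x w‖ ≠ 0 := norm_ne_zero_iff.2 hw
    have h := continuous_inner_gradient hf hG hB hL hx (v := ‖Pperp x w‖⁻¹ • Pperp x w)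
      (by simp [Sph, norm_smul, hw']) (by simp [inner_smul_right, inner_Pperp_self hx])
    simpa [inner_smul_right, hw'] using h.const_mul ‖Pperp x w‖
  rw [funext fun θ => ((EuclideanSpace.basisFun (Fin d) ℝ).sum_repr' (Pperp x (G x θ))).symm]
  exact continuous_finsetSum _ fun i _ => (hinner _).smul continuous_const

end Sphere

section UpperGradient

variable {d α : ℕ}

theorem isClosed_Sph : IsClosed (Sph d) := isClosed_eq continuous_norm continuous_const

theorem isCompact_Sph : IsCompact (Sph d) := by
  have h : Sph d = Metric.sphere (0 : Ed d) 1 := by ext; simp [Sph]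
  exact h ▸ isCompact_sphere _ _

theorem continuous_Pperp_gradient_coe {T : Type*} [TopologicalSpace T]
    {f : Ed d → Ed d → T → ℝ} {G : Ed d → Ed d → T → Ed d} {B L : ℝ}
    (hf : ∀ x y, Continuous (f x y))
    (hG : ∀ y θ x, HasGradientAt (fun x' => f x' y θ) (G x y θ) x)
    (hB : ∀ x y : Ed d, x ∈ Sph d → y ∈ Sph d → ∀ θ, ‖G x y θ‖ ≤ B)
    (hL : ∀ x x' y y' : Ed d, x ∈ Sph d → x' ∈ Sph d → y ∈ Sph d → y' ∈ Sph d →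
      ∀ θ, ‖G x y θ - G x' y' θ‖ ≤ L * (‖x - x'‖ + ‖y - y'‖)) :
    Continuous fun p : (Sph d × Sph d) × T =>
      Pperp (p.1.1 : Ed d) (G p.1.1 p.1.2 p.2) := by
  refine continuous_prod_of_continuous_lipschitzWith _ (4 * ‖L‖₊ + 2 * ‖B‖₊) ?_ fun θ => ?_
  · rintro ⟨⟨x, hx⟩, ⟨y, hy⟩⟩
    exact continuous_Pperp_gradient (f := fun x => f x y) (G := fun x => G x y)
      (fun x => hf x y) (hG y) (fun x hx => hB x y hx hy)
      (fun x hx x' hx' θ => by simpa using hL x x' y y hx hx' hy hy θ) hx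
  · refine LipschitzWith.of_dist_le_mul ?_
    rintro ⟨⟨x, hx⟩, ⟨y, hy⟩⟩ ⟨⟨x', hx'⟩, ⟨y', hy'⟩⟩
    set D := dist ((⟨x, hx⟩, ⟨y, hy⟩) : Sph d × Sph d) (⟨x', hx'⟩, ⟨y', hy'⟩) with hD
    have h₁ : ‖x - x'‖ ≤ D := by
      rw [← dist_eq_norm, hD, Prod.dist_eq]; exact le_max_left _ _
    have h₂ : ‖y - y'‖ ≤ D := by
      rw [← dist_eq_norm, hD, Prod.dist_eq]; exact le_max_right _ _
    have h₃ : ‖G x y θ - G x' y' θ‖ ≤ |L| * (D + D) :=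
      (hL x x' y y' hx hx' hy hy' θ).trans (by gcongr; exact le_abs_self L)
    have h₄ : ‖G x' y' θ‖ * ‖x - x'‖ ≤ |B| * D := by
      gcongr
      exact (hB x' y' hx' hy' θ).trans (le_abs_self B)
    rw [dist_eq_norm]
    refine (norm_Pperp_sub_le hx hx' _ _).trans ?_
    push_cast
    rw [Real.norm_eq_abs, Real.norm_eq_abs]
    linarith

/-- The upper gradient in terms of continuous data on the sphere and on the parameter set. -/
theorem Gup_eq_sqrt_integral_comap {M : Ed d → Ed d → Ed α → ℝ}
    {Kgrad : Ed d → Ed d → Ed α → Ed d} {c cbar : ℝ} (hc : 0 < c)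
    (hM : ∀ x z : Ed d, x ∈ Sph d → z ∈ Sph d → ∀ θ, c ≤ M x z θ ∧ M x z θ ≤ cbar)
    {Q : Set (Ed α)} (hQ : IsClosed Q) [CompactSpace Q] [CompactSpace (Sph d)]
    (m : C(Sph d × (Q × Sph d), ℝ)) (hm : ∀ p, m p = M p.2.2 p.1 p.2.1)
    (g : C(Sph d × (Q × Sph d), Ed d))
    (hg : ∀ p, g p = Pperp (p.2.2 : Ed d) (Kgrad p.2.2 p.1 p.2.1))
    {μ : Measure (Ed d)} [IsProbabilityMeasure μ] (hμ : μ (Sph d)ᶜ = 0)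
    {Θ : Measure (Ed α)} [IsProbabilityMeasure Θ] (hΘ : Θ Qᶜ = 0)
    {ν : Measure (Sph d)} (hν : ν = μ.comap Subtype.val)
    {τ : Measure Q} (hτ : τ = Θ.comap Subtype.val) :
    Gup M Kgrad μ Θ =
      √(∫ x, truncInv cbar⁻¹ (∫ θ, truncInv c (∫ z, m (z, θ, x) ∂ν) ∂τ) *
        ‖∫ θ, truncInv c (∫ z, m (z, θ, x) ∂ν) • ∫ y, g (y, θ, x) ∂ν ∂τ‖ ^ 2 ∂ν) := by
  have hS := (isClosed_Sph (d := d)).measurableSet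
  have : IsProbabilityMeasure ν := hν ▸ isProbabilityMeasure_comap_coe hS hμ
  have : IsProbabilityMeasure τ := hτ ▸ isProbabilityMeasure_comap_coe hQ.measurableSet hΘ
  have hint (p : Q × Sph d) : Integrable (fun z => m (z, p)) ν :=
    integrable_continuousMap ν (m.comp ((ContinuousMap.id _).prodMk (.const _ p)))
  have hlow (p : Q × Sph d) : c ≤ ∫ z, m (z, p) ∂ν := by
    have h := integral_mono (integrable_const c) (hint p) fun z => by
      simpa [hm] using (hM p.2 z p.2.2 z.2 p.1).1
    simpa using h
  have hup (p : Q × Sph d) : ∫ z, m (z, p) ∂ν ≤ cbar := by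
    have h := integral_mono (hint p) (integrable_const cbar) fun z => by
      simpa [hm] using (hM p.2 z p.2.2 z.2 p.1).2
    simpa using h
  have hmob (θ : Q) (x : Sph d) : (mMob M μ x θ)⁻¹ = truncInv c (∫ z, m (z, θ, x) ∂ν) := by
    rw [truncInv_of_le (hlow _), mMob, integral_eq_integral_comap_coe hS hμ, hν]
    simp only [hm]
  have hb (x : Sph d) : cbar⁻¹ ≤ ∫ θ, truncInv c (∫ z, m (z, θ, x) ∂ν) ∂τ := by
    let φ : C(Q, ℝ) := ⟨fun θ => truncInv c (average₁ ν m (θ, x)),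
      (continuous_truncInv hc).comp (by fun_prop)⟩
    have h := integral_mono (integrable_const cbar⁻¹) (integrable_continuousMap τ φ) fun θ => by
      simp only [φ, ContinuousMap.coe_mk, average₁_apply]
      rw [truncInv_of_le (hlow _)]
      exact inv_anti₀ (hc.trans_le (hlow _)) (hup _)
    simpa [φ, average₁_apply] using h
  rw [Gup, integral_eq_integral_comap_coe hS hμ, ← hν]
  congr 2 with x
  have hD (θ : Q) : DKer Kgrad μ x θ = ∫ y, g (y, θ, x) ∂ν := by
    rw [DKer, integral_eq_integral_comap_coe hS hμ, hν]
    simp only [hg]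
  rw [bEff, truncInv_of_le (hb x), integral_eq_integral_comap_coe hQ.measurableSet hΘ,
    integral_eq_integral_comap_coe hQ.measurableSet hΘ, ← hτ]
  simp only [hmob, hD]

end UpperGradient

/-- **Γ-liminf of the strong upper gradient.**
Under (K1)–(K3) for the kernel and (M) (with continuity) for the mobility
kernel, if `μ_n → μ` narrowly on the sphere and `Θ_n → Θ` narrowly with all
`Θ_n` supported in a fixed compact set, then
`liminf 𝒢(μ_n, Θ_n) ≥ 𝒢(μ, Θ)`. -/
theorem upper_gradient_gamma_liminf
    (d α : ℕ) (hd : 2 ≤ d) (hα : 1 ≤ α)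
    (K : Ed d → Ed d → Ed α → ℝ) (Kgrad : Ed d → Ed d → Ed α → Ed d)
    -- (K1)
    (QK : Set (Ed α)) (hQK : IsCompact QK)
    (hK1 : ∀ x y : Ed d, x ∈ Sph d → y ∈ Sph d → ∀ θ ∉ QK, K x y θ = 0)
    -- (K2)
    (hKC1 : ∀ θ, ContDiff ℝ 1 (fun p : Ed d × Ed d => K p.1 p.2 θ))
    (hgrad : ∀ y θ x, HasGradientAt (fun x' => K x' y θ) (Kgrad x y θ) x)
    (B LK : ℝ)
    (hB : ∀ x y : Ed d, x ∈ Sph d → y ∈ Sph d → ∀ θ, ‖Kgrad x y θ‖ ≤ B)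
    (hLK : ∀ x x' y y' : Ed d, x ∈ Sph d → x' ∈ Sph d → y ∈ Sph d → y' ∈ Sph d →
      ∀ θ, ‖Kgrad x y θ - Kgrad x' y' θ‖ ≤ LK * (‖x - x'‖ + ‖y - y'‖))
    (hKC2 : ∀ x y, ContDiff ℝ 2 (fun θ => K x y θ))
    -- (K3)
    (hK3 : ∀ x y θ, K x y θ = K y x θ)
    -- (M), with continuity
    (M : Ed d → Ed d → Ed α → ℝ)
    (hMcont : Continuous (fun p : Ed d × Ed d × Ed α => M p.1 p.2.1 p.2.2))
    (c cbar LM : ℝ) (hc : 0 < c) (hccbar : c ≤ cbar)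
    (hMbound : ∀ x z : Ed d, x ∈ Sph d → z ∈ Sph d → ∀ θ,
      c ≤ M x z θ ∧ M x z θ ≤ cbar)
    (hMLip : ∀ x x' z z' : Ed d, x ∈ Sph d → x' ∈ Sph d → z ∈ Sph d → z' ∈ Sph d →
      ∀ θ, |M x z θ - M x' z' θ| ≤ LM * (‖x - x'‖ + ‖z - z'‖))
    -- the converging sequences
    (μn : ℕ → Measure (Ed d)) (μ : Measure (Ed d))
    [∀ n, IsProbabilityMeasure (μn n)] [IsProbabilityMeasure μ]
    (hμsph : ∀ n, (μn n) (Sph d)ᶜ = 0) (hμsph' : μ (Sph d)ᶜ = 0)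
    (hμconv : NarrowTendsto μn μ)
    (Θn : ℕ → Measure (Ed α)) (Θ : Measure (Ed α))
    [∀ n, IsProbabilityMeasure (Θn n)] [IsProbabilityMeasure Θ]
    (QΘ : Set (Ed α)) (hQΘ : IsCompact QΘ)
    (hΘsupp : ∀ n, (Θn n) QΘᶜ = 0)
    (hΘconv : NarrowTendsto Θn Θ) :
    Gup M Kgrad μ Θ ≤ Filter.liminf (fun n => Gup M Kgrad (μn n) (Θn n)) atTop := by
  have : CompactSpace (Sph d) := isCompact_iff_compactSpace.1 isCompact_Sph
  have : CompactSpace QΘ := isCompact_iff_compactSpace.1 hQΘ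
  have hQcl := hQΘ.isClosed
  have hΘ' : Θ QΘᶜ = 0 := hΘconv.compl_eq_zero hQcl hΘsupp
  have hS := (isClosed_Sph (d := d)).measurableSet
  let m : C(Sph d × (QΘ × Sph d), ℝ) := ⟨fun p => M p.2.2 p.1 p.2.1,
    hMcont.comp (f := fun p : Sph d × (QΘ × Sph d) =>
      ((p.2.2 : Ed d), (p.1 : Ed d), (p.2.1 : Ed α))) (by fun_prop)⟩
  let g : C(Sph d × (QΘ × Sph d), Ed d) :=
    ⟨fun p => Pperp (p.2.2 : Ed d) (Kgrad p.2.2 p.1 p.2.1),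
      (continuous_Pperp_gradient_coe (fun x y => (hKC2 x y).continuous) hgrad hB hLK).comp
        (f := fun p : Sph d × (QΘ × Sph d) => ((p.2.2, p.1), (p.2.1 : Ed α))) (by fun_prop)⟩
  have := fun n => isProbabilityMeasure_comap_coe hS (hμsph n)
  have := isProbabilityMeasure_comap_coe hS hμsph'
  have := fun n => isProbabilityMeasure_comap_coe hQcl.measurableSet (hΘsupp n)
  have := isProbabilityMeasure_comap_coe hQcl.measurableSet hΘ'
  have hlim : Tendsto (fun n => Gup M Kgrad (μn n) (Θn n)) atTop (𝓝 (Gup M Kgrad μ Θ)) := by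
    have h := (tendsto_integral_sq_gradient hc (inv_pos.2 (hc.trans_le hccbar)) m g
      (hμconv.comap_coe isCompact_Sph isClosed_Sph hμsph hμsph')
      (hΘconv.comap_coe hQΘ hQcl hΘsupp hΘ')).sqrt
    rw [Gup_eq_sqrt_integral_comap hc hMbound hQcl m (fun _ => rfl) g (fun _ => rfl) hμsph' hΘ'
      rfl rfl]
    refine h.congr fun n => ?_
    rw [Gup_eq_sqrt_integral_comap hc hMbound hQcl m (fun _ => rfl) g (fun _ => rfl) (hμsph n)
      (hΘsupp n) rfl rfl]
  exact hlim.liminf_eq.ge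

end
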